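/- arXiv:2604.11301 — 3 statements merged into one kernel-verified Lean document; each statement's English description precedes it below -/
import Mathlib

section
/- Let K ⊆ L be number fields with L a finite extension of K, and let p be a prime number. If p divides the class number of K and p does not divide the degree [L : K], then p divides the class number of L. -/
/-- A class that becomes trivial in a finite extension is killed by the degree of the extension. -/
theorem ClassGroup.pow_finrank_eq_one_of_extendedHom_eq_one {A B : Type*} [CommRing A]
    [CommRing B] [IsDedekindDomain A] [IsDedekindDomain B] [Algebra A B] [Module.Finite A B]
    [Module.IsTorsionFree A B] {x : ClassGroup A} (hx : ClassGroup.extendedHom A B x = 1) :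
    x ^ Module.finrank A B = 1 := by
  obtain ⟨I, rfl⟩ := ClassGroup.mk0_surjective x
  rw [ClassGroup.extendedHom_mk0, ClassGroup.mk0_eq_one_iff] at hx
  obtain ⟨b, hb⟩ := hx.principal
  rw [← map_pow]
  refine (ClassGroup.mk0_eq_one_iff (I ^ Module.finrank A B).2).2 ⟨Algebra.intNorm A B b, ?_⟩
  change (I : Ideal A) ^ _ = Ideal.span _
  rw [← Ideal.relNorm_singleton, ← Ideal.relNorm_algebraMap B]
  exact congrArg _ hb

/-- If `K ⊆ L` are number fields with `L` finite over `K`, `p` is a prime dividing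
the class number of `K`, and `p` does not divide the degree `[L : K]`, then `p`
divides the class number of `L`. -/
theorem stmt_1 (K L : Type*) [Field K] [Field L] [NumberField K] [NumberField L]
    [Algebra K L] [FiniteDimensional K L] (p : ℕ) (hp : p.Prime)
    (hK : p ∣ NumberField.classNumber K)
    (hdeg : ¬ p ∣ Module.finrank K L) :
    p ∣ NumberField.classNumber L := by
  have : Fact p.Prime := ⟨hp⟩
  obtain ⟨x, hx⟩ := exists_prime_orderOf_dvd_card p hK
  let φ := ClassGroup.extendedHom (NumberField.RingOfIntegers K) (NumberField.RingOfIntegers L)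
  have hφx : φ x ≠ 1 := fun h ↦ hdeg <| by
    rw [IsFractionRing.finrank_eq (NumberField.RingOfIntegers K) K
      (NumberField.RingOfIntegers L) L, ← hx]
    exact orderOf_dvd_of_pow_eq_one (ClassGroup.pow_finrank_eq_one_of_extendedHom_eq_one h)
  have hφxp : φ x ^ p = 1 := by rw [← map_pow, ← hx, pow_orderOf_eq_one, map_one]
  rw [← orderOf_eq_prime hφxp hφx]
  exact orderOf_dvd_card
end

section
/- There exist infinitely many pairwise distinct number fields L, each containing the 5-th cyclotomic field Q(ζ_5) as a subfield and finite over Q, such that 5 divides the class number of L. -/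
open NumberField Module

instance fact_not_sq_neg47 : Fact (∀ r : ℚ, r ^ 2 ≠ (-47) + 0 * r) :=
  ⟨fun r h => by nlinarith [sq_nonneg r]⟩

/-- The imaginary quadratic field `ℚ(√-47)`. -/
abbrev QSqrtNeg47 : Type := QuadraticAlgebra ℚ (-47) 0

namespace QSqrtNeg47

theorem norm_eq (z : QSqrtNeg47) : z.norm = z.re ^ 2 + 47 * z.im ^ 2 := by
  rw [QuadraticAlgebra.norm_def]; ring

theorem isIntegral_star {z : QSqrtNeg47} (hz : IsIntegral ℤ z) : IsIntegral ℤ (star z) :=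
  map_isIntegral_int (starRingEnd QSqrtNeg47) hz

theorem exists_int_of_isIntegral_algebraMap {q : ℚ}
    (hq : IsIntegral ℤ (algebraMap ℚ QSqrtNeg47 q)) : ∃ n : ℤ, (n : ℚ) = q := by
  have h : IsIntegral ℤ q :=
    (isIntegral_algebraMap_iff (QuadraticAlgebra.algebraMap_injective)).1 hq
  simpa using IsIntegrallyClosed.isIntegral_iff.1 h

theorem exists_int_eq_norm {z : QSqrtNeg47} (hz : IsIntegral ℤ z) :
    ∃ n : ℤ, (n : ℚ) = z.norm :=
  exists_int_of_isIntegral_algebraMap <| by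
    have h := hz.mul (isIntegral_star hz)
    rw [← QuadraticAlgebra.algebraMap_norm_eq_mul_star] at h
    convert! h

theorem exists_int_eq_two_mul_re {z : QSqrtNeg47} (hz : IsIntegral ℤ z) :
    ∃ n : ℤ, (n : ℚ) = 2 * z.re :=
  exists_int_of_isIntegral_algebraMap <| by
    have h := hz.add (isIntegral_star hz)
    rw [← QuadraticAlgebra.algebraMap_trace_eq_add_star, QuadraticAlgebra.trace_def] at h
    simpa using h

theorem norm_eq_one_of_mul_eq_one {x y : QSqrtNeg47} (hx : IsIntegral ℤ x)
    (hy : IsIntegral ℤ y) (hxy : x * y = 1) : x.norm = 1 := by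
  obtain ⟨m, hm⟩ := exists_int_eq_norm hx
  obtain ⟨n, hn⟩ := exists_int_eq_norm hy
  have hmn : m * n = 1 := by
    have := congrArg QuadraticAlgebra.norm hxy
    rw [map_mul, ← hm, ← hn, map_one] at this
    exact_mod_cast this
  have hm0 : 0 ≤ m := by
    have : (0 : ℚ) ≤ m := by rw [hm, norm_eq]; positivity
    exact_mod_cast this
  rw [← hm, Int.eq_one_or_neg_one_of_mul_eq_one hmn |>.resolve_right (by omega)]
  simp

theorem norm_ne_two {z : QSqrtNeg47} (hz : IsIntegral ℤ z) : z.norm ≠ 2 := by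
  intro h
  obtain ⟨t, ht⟩ := exists_int_eq_two_mul_re hz
  rw [norm_eq] at h
  have key : (t : ℚ) ^ 2 + 47 * (2 * z.im) ^ 2 = 8 := by rw [ht]; linarith
  -- multiplied by `47`, the identity makes `47 * (8 - t ^ 2)` a rational square
  have hsq : IsSquare ((47 * (8 - t ^ 2) : ℤ) : ℚ) :=
    ⟨47 * (2 * z.im), by push_cast; linarith⟩
  rw [Rat.isSquare_intCast_iff] at hsq
  have hle : t ^ 2 ≤ 8 := by
    have : (t : ℚ) ^ 2 ≤ 8 := by nlinarith [sq_nonneg (2 * z.im)]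
    exact_mod_cast this
  have h1 : -3 < t := by nlinarith
  have h2 : t < 3 := by nlinarith
  interval_cases t <;> revert hsq <;> norm_num

/-- The element `(9 + √-47) / 2`, whose norm is `2 ^ 5`. -/
def alpha : QSqrtNeg47 := ⟨9 / 2, 1 / 2⟩

theorem norm_alpha : alpha.norm = 2 ^ 5 := by
  rw [norm_eq]; norm_num [alpha]

theorem alpha_ne_zero : alpha ≠ 0 := fun h => by
  have := norm_alpha
  rw [h] at this
  norm_num at this

theorem alpha_add_star : alpha + star alpha = 9 := by
  ext <;> norm_num [alpha] <;> rfl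

theorem alpha_mul_star : alpha * star alpha = 2 ^ 5 := by
  rw [← QuadraticAlgebra.algebraMap_norm_eq_mul_star, norm_alpha]
  simp

theorem isIntegral_alpha : IsIntegral ℤ alpha := by
  refine ⟨Polynomial.X ^ 2 - Polynomial.C 9 * Polynomial.X + Polynomial.C 32, by monicity!, ?_⟩
  have h : star alpha = 9 - alpha := eq_sub_of_add_eq' alpha_add_star
  have h2 := alpha_mul_star
  rw [h] at h2
  simp
  linear_combination -h2

theorem pow_five_ne_mul_alpha {x e : QSqrtNeg47} (he : IsIntegral ℤ e) (hn : e.norm = 1) :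
    x ^ 5 ≠ e * alpha := by
  intro h
  have hx : IsIntegral ℤ x :=
    IsIntegral.of_pow (by norm_num : 0 < 5) (h ▸ he.mul isIntegral_alpha)
  apply norm_ne_two hx
  have := congrArg QuadraticAlgebra.norm h
  rw [map_pow, map_mul, hn, norm_alpha, one_mul] at this
  exact (Odd.strictMono_pow (by decide : Odd 5)).injective this

theorem pow_five_ne_mul_alpha_pow {x e : QSqrtNeg47} (he : IsIntegral ℤ e) (hn : e.norm = 1)
    {d : ℕ} (hd : ¬ 5 ∣ d) : x ^ 5 ≠ e * alpha ^ d := by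
  intro h
  obtain ⟨v, w, hvw⟩ : ∃ v w : ℕ, d * v = 5 * w + 1 := by
    have : d.Coprime 5 := ((Nat.Prime.coprime_iff_not_dvd (by norm_num)).2 hd).symm
    obtain ⟨v, hv⟩ := Nat.exists_mul_mod_eq_one_of_coprime this (by norm_num)
    exact ⟨v, d * v / 5, by omega⟩
  refine pow_five_ne_mul_alpha (x := x ^ v / alpha ^ w) (he.pow v) (by rw [map_pow, hn, one_pow]) ?_
  have h1 : (x ^ v) ^ 5 = e ^ v * (alpha ^ (5 * w) * alpha) := by
    rw [← pow_succ, ← hvw, pow_mul, ← mul_pow, ← h]; ring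
  rw [div_pow, h1, ← pow_mul, mul_comm w 5]
  have h2 : alpha ^ (5 * w) ≠ 0 := pow_ne_zero _ alpha_ne_zero
  rw [← mul_assoc, mul_right_comm, mul_div_cancel_right₀ _ h2]

end QSqrtNeg47

/-- If the class number is prime to `n`, an ideal whose `n`-th power is principal is principal. -/
theorem NumberField.isPrincipal_of_pow_eq_span {L : Type*} [Field L] [NumberField L] {n : ℕ}
    (hn : (classNumber L).Coprime n) {I : Ideal (𝓞 L)} {a : 𝓞 L}
    (hI : I ^ n = Ideal.span {a}) : I.IsPrincipal := by
  by_cases hI0 : I = ⊥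
  · rw [hI0]; exact bot_isPrincipal
  have hmem : I ∈ nonZeroDivisors (Ideal (𝓞 L)) := mem_nonZeroDivisors_of_ne_zero hI0
  have hone : ClassGroup.mk0 ⟨I, hmem⟩ ^ n = 1 := by
    rw [← map_pow, ClassGroup.mk0_eq_one_iff]
    change (I ^ n).IsPrincipal
    rw [hI]
    exact ⟨a, rfl⟩
  rw [← ClassGroup.mk0_eq_one_iff hmem]
  have hcard : (Nat.card (ClassGroup (𝓞 L))).Coprime n := by
    rwa [Nat.card_eq_fintype_card]
  exact hcard.pow_left_bijective.injective (by simpa using hone)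

/-- If `L ⊇ ℚ(√-47)` has degree prime to `5`, then the class number of `L` is divisible by `5`. -/
theorem five_dvd_classNumber_of_algebra {L : Type*} [Field L] [NumberField L]
    [Algebra QSqrtNeg47 L] (hd : ¬ 5 ∣ finrank ℚ L) : 5 ∣ classNumber L := by
  have : IsScalarTower ℚ QSqrtNeg47 L := .of_algebraMap_eq' (Subsingleton.elim _ _)
  have : FiniteDimensional QSqrtNeg47 L := .right ℚ _ _
  by_contra h5
  have hd' : ¬ 5 ∣ finrank QSqrtNeg47 L := fun h =>
    hd (finrank_mul_finrank ℚ QSqrtNeg47 L ▸ h.mul_left _)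
  let f := algebraMap QSqrtNeg47 L
  let a : 𝓞 L := ⟨f .alpha, map_isIntegral_int f QSqrtNeg47.isIntegral_alpha⟩
  let b : 𝓞 L := ⟨f (star .alpha),
    map_isIntegral_int f (QSqrtNeg47.isIntegral_star QSqrtNeg47.isIntegral_alpha)⟩
  have hadd : a + b = 9 := by
    ext
    change f .alpha + f (star .alpha) = 9
    rw [← map_add, QSqrtNeg47.alpha_add_star, map_ofNat]
  have hmul : a * b = 2 ^ 5 := by
    ext
    change f .alpha * f (star .alpha) = 2 ^ 5
    rw [← map_mul, QSqrtNeg47.alpha_mul_star, map_pow, map_ofNat]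
  -- `1 = 9 * 57 - 32 * 16`
  have hcop : IsCoprime (Ideal.span {a}) (Ideal.span {b}) := by
    rw [Ideal.isCoprime_span_singleton_iff]
    exact ⟨57 - 16 * b, 57, by linear_combination 57 * hadd - 16 * hmul⟩
  obtain ⟨I, hI⟩ := exists_eq_pow_of_mul_eq_pow_of_coprime hcop
    (show Ideal.span {a} * Ideal.span {b} = Ideal.span {2} ^ 5 by
      rw [Ideal.span_singleton_mul_span_singleton, hmul, Ideal.span_singleton_pow])
  have hcl : (classNumber L).Coprime 5 :=
    ((Nat.Prime.coprime_iff_not_dvd (by norm_num)).2 h5).symm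
  obtain ⟨β, rfl⟩ := isPrincipal_of_pow_eq_span hcl hI.symm
  rw [← Ideal.span, Ideal.span_singleton_pow, Ideal.span_singleton_eq_span_singleton] at hI
  obtain ⟨u, hu⟩ := hI
  let N := Algebra.norm QSqrtNeg47 (S := L)
  have hN (x : 𝓞 L) : IsIntegral ℤ (N x) := Algebra.isIntegral_norm _ x.2
  have hmain : N β ^ 5 = N (u : 𝓞 L) * QSqrtNeg47.alpha ^ finrank QSqrtNeg47 L := by
    rw [← map_pow, ← Algebra.norm_algebraMap, mul_comm, ← map_mul]
    congr 1
    exact (map_pow (algebraMap (𝓞 L) L) β 5).symm.trans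
      ((congrArg (algebraMap (𝓞 L) L) hu.symm).trans (map_mul _ a u))
  refine QSqrtNeg47.pow_five_ne_mul_alpha_pow (hN u) ?_ hd' hmain
  refine QSqrtNeg47.norm_eq_one_of_mul_eq_one (hN u) (hN ↑u⁻¹) ?_
  rw [← map_mul, ← map_mul, Units.mul_inv, map_one, map_one]

theorem five_dvd_classNumber_of_sq_eq {L : Type*} [Field L] [NumberField L] {s : L}
    (hs : s ^ 2 = -47) (hd : ¬ 5 ∣ finrank ℚ L) : 5 ∣ classNumber L :=
  letI : Algebra QSqrtNeg47 L := (QuadraticAlgebra.lift (R := ℚ) (a := -47) (b := 0)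
    ⟨s, by rw [← pow_two, hs]; simp [Algebra.smul_def]⟩).toRingHom.toAlgebra
  five_dvd_classNumber_of_algebra hd

/-- The quadratic Gauss sum for the prime `47` is a square root of `-47`. -/
theorem IsPrimitiveRoot.exists_sq_eq_neg47 {L : Type*} [Field L] [CharZero L] {ζ : L}
    (hζ : IsPrimitiveRoot ζ 47) : ∃ s : L, s ^ 2 = -47 := by
  have : Fact (Nat.Prime 47) := ⟨by norm_num⟩
  let χ : MulChar (ZMod 47) L := (quadraticChar (ZMod 47)).ringHomComp (Int.castRingHom L)
  have hχ : χ (-1) = -1 := by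
    have : quadraticChar (ZMod 47) (-1) = -1 := by
      rw [quadraticChar_neg_one_iff_not_isSquare, ZMod.exists_sq_eq_neg_one_iff]; norm_num
    simp [χ, this]
  refine ⟨gaussSum χ (AddChar.zmodChar 47 hζ.pow_eq_one), ?_⟩
  rw [gaussSum_sq ?_ ((quadraticChar_isQuadratic _).comp _)
    (AddChar.zmodChar_primitive_of_primitive_root 47 hζ), hχ]
  · simp [ZMod.card]
  · intro h
    rw [show χ = 1 from h, MulChar.one_apply (isUnit_one.neg)] at hχ
    norm_num at hχ

/-- There exist infinitely many pairwise distinct number fields `L` (realized as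
finite-dimensional subfields of a fixed algebraic closure of `ℚ`) containing the
5-th cyclotomic field `ℚ(ζ_5)` (i.e. containing a primitive 5-th root of unity)
such that `5` divides the class number of `L`. -/
theorem stmt_4 :
    {L : IntermediateField ℚ (AlgebraicClosure ℚ) |
      ∃ hL : FiniteDimensional ℚ L,
        (∃ ζ : L, IsPrimitiveRoot ζ 5) ∧
        5 ∣ @NumberField.classNumber L _ (@NumberField.mk L _ inferInstance hL)}.Infinite := by
  have hex (n : ℕ) : ∃ L : IntermediateField ℚ (AlgebraicClosure ℚ),
      IsCyclotomicExtension {235 * 2 ^ (n + 1)} ℚ L := by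
    obtain ⟨ζ, hζ⟩ := HasEnoughRootsOfUnity.exists_primitiveRoot (AlgebraicClosure ℚ)
      (235 * 2 ^ (n + 1))
    have : Algebra.IsIntegral ℚ (AlgebraicClosure ℚ) := by
      convert! (AlgebraicClosure.isAlgebraic ℚ).isIntegral
    exact ⟨_, hζ.intermediateField_adjoin_isCyclotomicExtension ℚ⟩
  choose F hF using hex
  have hfin (n : ℕ) : finrank ℚ (F n) = 184 * 2 ^ n := by
    rw [IsCyclotomicExtension.finrank (n := 235 * 2 ^ (n + 1)) (F n)
      (Polynomial.cyclotomic.irreducible_rat (by positivity)),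
      Nat.totient_mul (Nat.Coprime.pow_right _ (by norm_num)),
      Nat.totient_prime_pow_succ Nat.prime_two, show Nat.totient 235 = 184 by decide +kernel]
    ring
  refine Set.infinite_of_injective_forall_mem (f := F) (fun m n h => ?_) fun n => ?_
  · have : 184 * 2 ^ m = 184 * 2 ^ n := by rw [← hfin, ← hfin, h]
    exact Nat.pow_right_injective le_rfl (Nat.eq_of_mul_eq_mul_left (by norm_num) this)
  · have hL : FiniteDimensional ℚ (F n) :=
      IsCyclotomicExtension.finiteDimensional {235 * 2 ^ (n + 1)} ℚ (F n)
    have hζ := IsCyclotomicExtension.zeta_spec (235 * 2 ^ (n + 1)) ℚ (F n)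
    have hpos : 0 < 235 * 2 ^ (n + 1) := by positivity
    have : NumberField (F n) := ⟨⟩
    refine ⟨hL, ⟨_, hζ.pow hpos (a := 47 * 2 ^ (n + 1)) (by ring)⟩, ?_⟩
    obtain ⟨s, hs⟩ := (hζ.pow hpos (a := 5 * 2 ^ (n + 1)) (b := 47) (by ring)).exists_sq_eq_neg47
    refine five_dvd_classNumber_of_sq_eq hs ?_
    rw [hfin]
    intro h
    rcases (Nat.Prime.dvd_mul (by norm_num)).1 h with h | h
    · norm_num at h
    · have := Nat.Prime.dvd_of_dvd_pow (by norm_num) h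
      norm_num at this
end

section
/- For every prime number p, there exist infinitely many pairwise distinct number fields L such that p divides the class number of L. -/
open NumberField IntermediateField

/-- If `p` is prime to the class number, then a factor of a `p`-th power that is coprime to its
cofactor is itself a `p`-th power up to a unit. -/
theorem associated_pow_of_mul_eq_pow_of_not_dvd_card_classGroup {R : Type*} [CommRing R]
    [IsDedekindDomain R] [Fintype (ClassGroup R)] {p : ℕ} (hp : p.Prime)
    (hcard : ¬ p ∣ Fintype.card (ClassGroup R)) {x y m : R} (hxy : IsCoprime x y) (hx : x ≠ 0)
    (h : x * y = m ^ p) : ∃ z : R, Associated (z ^ p) x := by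
  obtain ⟨I, hI⟩ : ∃ I : Ideal R, Ideal.span {x} = I ^ p :=
    exists_eq_pow_of_mul_eq_pow_of_coprime
      ((Ideal.isCoprime_span_singleton_iff x y).2 hxy) (c := Ideal.span {m})
      (by rw [Ideal.span_singleton_mul_span_singleton, Ideal.span_singleton_pow, h])
  have hI0 : I ≠ 0 := by
    rintro rfl
    rw [zero_pow hp.ne_zero, Ideal.zero_eq_bot, Ideal.span_singleton_eq_bot] at hI
    exact hx hI
  have hmem : I ∈ nonZeroDivisors (Ideal R) := mem_nonZeroDivisors_of_ne_zero hI0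
  have hpow : ClassGroup.mk0 ⟨I, hmem⟩ ^ p = 1 := by
    rw [← map_pow, SubmonoidClass.mk_pow, ClassGroup.mk0_eq_one_iff, ← hI]
    exact ⟨⟨x, rfl⟩⟩
  have hone : ClassGroup.mk0 ⟨I, hmem⟩ = 1 := by
    have h1 := orderOf_dvd_of_pow_eq_one hpow
    have h2 := orderOf_dvd_card (x := ClassGroup.mk0 ⟨I, hmem⟩)
    rcases (Nat.dvd_prime hp).1 h1 with h3 | h3
    · exact orderOf_eq_one_iff.1 h3
    · exact absurd (h3 ▸ h2) hcard
  obtain ⟨⟨z, hz⟩⟩ := (ClassGroup.mk0_eq_one_iff hmem).1 hone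
  refine ⟨z, ?_⟩
  rw [← Ideal.span_singleton_eq_span_singleton, ← Ideal.span_singleton_pow, hI, hz]

section ImaginaryQuadratic

universe u

variable {K : Type u} [Field K] [NumberField K] {s : K} {D : ℤ}

theorem exists_intCast_eq_of_isIntegral_ratCast {x : ℚ} (hx : IsIntegral ℤ (x : K)) :
    ∃ n : ℤ, (n : ℚ) = x := by
  rw [← eq_ratCast (algebraMap ℚ K) x,
    isIntegral_algebraMap_iff (algebraMap ℚ K).injective] at hx
  simpa using IsIntegrallyClosed.isIntegral_iff.1 hx

theorem isIntegral_conj (hs : s ^ 2 = D) (hD : D < 0) {x y : ℚ}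
    (h : IsIntegral ℤ ((x : K) + y * s)) : IsIntegral ℤ ((x : K) - y * s) := by
  obtain ⟨φ⟩ : Nonempty (K →+* ℂ) := inferInstance
  have hφ : φ s ^ 2 = (D : ℝ) := by simp [← map_pow, hs]
  have him := congrArg Complex.im hφ
  have hre := congrArg Complex.re hφ
  simp only [pow_two, Complex.mul_re, Complex.mul_im, Complex.ofReal_re, Complex.ofReal_im]
    at him hre
  have hD' : (D : ℝ) < 0 := by exact_mod_cast hD
  have hre0 : (φ s).re = 0 := by
    rcases mul_eq_zero.1 (show (φ s).re * (φ s).im = 0 by linarith) with h0 | h0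
    · exact h0
    · rw [h0] at hre
      nlinarith [mul_self_nonneg (φ s).re]
  have hconj : (starRingEnd ℂ) (φ s) = -φ s := by
    apply Complex.ext <;> simp [hre0]
  have h1 : IsIntegral ℤ (((starRingEnd ℂ).comp φ) ((x : K) + y * s)) :=
    h.map ((starRingEnd ℂ).comp φ).toIntAlgHom
  have h2 : ((starRingEnd ℂ).comp φ) ((x : K) + y * s) = φ.toIntAlgHom ((x : K) - y * s) := by
    simp [hconj, sub_eq_add_neg]
  rw [h2] at h1
  exact (isIntegral_algHom_iff φ.toIntAlgHom φ.injective).1 h1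

theorem exists_int_of_isIntegral (hs : s ^ 2 = D) (hD : D < 0) {x y : ℚ}
    (h : IsIntegral ℤ ((x : K) + y * s)) :
    ∃ X Y N : ℤ, (X : ℚ) = 2 * x ∧ (Y : ℚ) = 2 * D * y ∧ (N : ℚ) = x ^ 2 - D * y ^ 2 := by
  have hc := isIntegral_conj hs hD h
  have hsI : IsIntegral ℤ s := by
    apply IsIntegral.of_pow (n := 2) (by norm_num)
    rw [hs]
    exact isIntegral_algebraMap
  obtain ⟨X, hX⟩ := exists_intCast_eq_of_isIntegral_ratCast (K := K) (x := 2 * x) (by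
    have key : ((2 * x : ℚ) : K) = x + y * s + (x - y * s) := by push_cast; ring
    exact key ▸ h.add hc)
  obtain ⟨Y, hY⟩ := exists_intCast_eq_of_isIntegral_ratCast (K := K) (x := 2 * D * y) (by
    have key : ((2 * D * y : ℚ) : K) = s * (x + y * s - (x - y * s)) := by
      push_cast; rw [← hs]; ring
    exact key ▸ hsI.mul (h.sub hc))
  obtain ⟨N, hN⟩ := exists_intCast_eq_of_isIntegral_ratCast (K := K) (x := x ^ 2 - D * y ^ 2) (by
    have key : ((x ^ 2 - D * y ^ 2 : ℚ) : K) = (x + y * s) * (x - y * s) := by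
      push_cast; rw [← hs]; ring
    exact key ▸ h.mul hc)
  exact ⟨X, Y, N, hX, hY, hN⟩

theorem ne_ratCast (hs : s ^ 2 = D) (hD : D < 0) (x : ℚ) : s ≠ x := by
  rintro rfl
  have : x ^ 2 = (D : ℚ) := by exact_mod_cast hs
  have hD' : (D : ℚ) < 0 := by exact_mod_cast hD
  nlinarith [sq_nonneg x]

theorem unit_pow_twelve_eq_one (hs : s ^ 2 = D) (hD : D < 0)
    (hgen : ∀ z : K, ∃ x y : ℚ, z = x + y * s) (u : (𝓞 K)ˣ) : (u : 𝓞 K) ^ 12 = 1 := by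
  obtain ⟨x, y, hxy⟩ := hgen (u : 𝓞 K)
  obtain ⟨x', y', hxy'⟩ := hgen ((u⁻¹ : (𝓞 K)ˣ) : 𝓞 K)
  obtain ⟨X, Y, N, hX, hY, hN⟩ := exists_int_of_isIntegral (x := x) (y := y) hs hD
    (by rw [← hxy]; exact RingOfIntegers.isIntegral_coe _)
  obtain ⟨X', Y', N', hX', hY', hN'⟩ := exists_int_of_isIntegral (x := x') (y := y') hs hD
    (by rw [← hxy']; exact RingOfIntegers.isIntegral_coe _)
  have hD' : (D : ℚ) < 0 := by exact_mod_cast hD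
  have hmul : ((x : K) + y * s) * (x' + y' * s) = 1 := by
    rw [← hxy, ← hxy', ← map_mul]
    simp
  have hcoord : ((x * x' + D * (y * y') - 1 : ℚ) : K) + ((x * y' + y * x' : ℚ) : K) * s = 0 := by
    push_cast
    rw [← hs]
    linear_combination hmul
  have h2 : x * y' + y * x' = 0 := by
    by_contra hne
    apply ne_ratCast hs hD (-(x * x' + D * (y * y') - 1) / (x * y' + y * x'))
    have : ((x * y' + y * x' : ℚ) : K) ≠ 0 := by exact_mod_cast hne
    rw [Rat.cast_div, eq_div_iff this, Rat.cast_neg]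
    linear_combination hcoord
  have h1 : x * x' + D * (y * y') - 1 = 0 := by
    rw [h2, Rat.cast_zero, zero_mul, add_zero] at hcoord
    exact_mod_cast hcoord
  have hNN : N * N' = 1 := by
    have : (N : ℚ) * N' = 1 := by
      rw [hN, hN']
      linear_combination (x * x' + D * (y * y') + 1) * h1 - D * (x * y' + y * x') * h2
    exact_mod_cast this
  have hN0 : 0 ≤ N := by
    have : (0 : ℚ) ≤ N := by
      rw [hN]; nlinarith [sq_nonneg x, sq_nonneg y]
    exact_mod_cast this
  have hN1 : N = 1 := by
    rcases Int.mul_eq_one_iff_eq_one_or_neg_one.1 hNN with h | h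
    · exact h.1
    · omega
  have hX2 : X ^ 2 ≤ 4 := by
    have : (X : ℚ) ^ 2 ≤ 4 := by
      rw [hX]
      rw [hN1, Int.cast_one] at hN
      nlinarith [sq_nonneg y]
    exact_mod_cast this
  have hquad : (u : 𝓞 K) ^ 2 - X * u + 1 = 0 := by
    apply RingOfIntegers.coe_injective
    have hXK : (X : K) = 2 * x := by exact_mod_cast congrArg (Rat.cast : ℚ → K) hX
    have hNK : (1 : K) = x ^ 2 - D * y ^ 2 := by
      rw [hN1] at hN
      exact_mod_cast congrArg (Rat.cast : ℚ → K) hN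
    simp only [map_add, map_sub, map_mul, map_pow, map_intCast, map_one, map_zero, hxy]
    rw [hXK]
    linear_combination hNK + (y : K) ^ 2 * hs
  have hlow : -2 ≤ X := by nlinarith
  have hupp : X ≤ 2 := by nlinarith
  generalize (u : 𝓞 K) = v at hquad
  interval_cases X
  · have : v + 1 = 0 := by
      apply pow_eq_zero_iff (n := 2) (by norm_num) |>.1
      push_cast at hquad
      linear_combination hquad
    rw [eq_neg_of_add_eq_zero_left this]; norm_num
  · have : v ^ 3 = 1 := by push_cast at hquad; linear_combination (v - 1) * hquad
    rw [show 12 = 3 * 4 by norm_num, pow_mul, this, one_pow]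
  · have : v ^ 4 = 1 := by push_cast at hquad; linear_combination (v ^ 2 - 1) * hquad
    rw [show 12 = 4 * 3 by norm_num, pow_mul, this, one_pow]
  · have : v ^ 6 = 1 := by
      push_cast at hquad; linear_combination (v ^ 3 - 1) * (v + 1) * hquad
    rw [show 12 = 6 * 2 by norm_num, pow_mul, this, one_pow]
  · have : v - 1 = 0 := by
      apply pow_eq_zero_iff (n := 2) (by norm_num) |>.1
      push_cast at hquad
      linear_combination hquad
    rw [sub_eq_zero.1 this, one_pow]

theorem frobenius_map_eq_self {k : Type*} [Field k] {l : ℕ} [Fact l.Prime] [CharP k l]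
    (π : 𝓞 K →+* k) {σ : 𝓞 K} (hσ : (σ : K) ^ 2 = D) (hD : D < 0)
    (hgen : ∀ z : K, ∃ x y : ℚ, z = x + y * σ) (hfix : π σ ^ l = π σ)
    (hne : ((2 * D : ℤ) : k) ≠ 0) (z : 𝓞 K) : π z ^ l = π z := by
  obtain ⟨x, y, hxy⟩ := hgen z
  obtain ⟨X, Y, N, hX, hY, -⟩ := exists_int_of_isIntegral (x := x) (y := y) hσ hD
    (by rw [← hxy]; exact RingOfIntegers.isIntegral_coe _)
  have hz : ((2 * D : ℤ) : 𝓞 K) * z = (D * X : ℤ) + Y * σ := by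
    apply RingOfIntegers.coe_injective
    have hXK : (X : K) = 2 * x := by exact_mod_cast congrArg (Rat.cast : ℚ → K) hX
    have hYK : (Y : K) = 2 * D * y := by exact_mod_cast congrArg (Rat.cast : ℚ → K) hY
    simp only [map_add, map_mul, map_intCast, hxy]
    push_cast
    rw [hXK, hYK]
    ring
  have hk := congrArg π hz
  simp only [map_add, map_mul, map_intCast] at hk
  have hfrob := congrArg (frobenius k l) hk
  simp only [map_add, map_mul, map_intCast] at hfrob
  rw [frobenius_def (p := l) (π σ), hfix, ← hk] at hfrob
  exact mul_left_cancel₀ hne hfrob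

theorem exists_ringHom_charP (l : ℕ) (hl : l.Prime) :
    ∃ (k : Type u) (_ : Field k) (_ : CharP k l), Nonempty (𝓞 K →+* k) := by
  have hne : Ideal.span {(l : 𝓞 K)} ≠ ⊤ := by
    intro h
    obtain ⟨w, hw⟩ := isUnit_iff_exists_inv.1 (Ideal.span_singleton_eq_top.1 h)
    have hl0 : (l : K) ≠ 0 := by exact_mod_cast hl.ne_zero
    have hwK : (((l : ℚ)⁻¹ : ℚ) : K) = w := by
      have := congrArg (algebraMap (𝓞 K) K) hw
      simp only [map_mul, map_natCast, map_one] at this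
      push_cast
      rw [inv_eq_iff_eq_inv, eq_comm, inv_eq_iff_eq_inv]
      exact eq_inv_of_mul_eq_one_right this
    obtain ⟨n, hn⟩ := exists_intCast_eq_of_isIntegral_ratCast (K := K) (x := (l : ℚ)⁻¹)
      (hwK ▸ RingOfIntegers.isIntegral_coe w)
    have hl0' : (l : ℚ) ≠ 0 := by exact_mod_cast hl.ne_zero
    have h1 : (n : ℚ) * l = 1 := by rw [hn, inv_mul_cancel₀ hl0']
    have h2 : n * (l : ℤ) = 1 := by exact_mod_cast h1
    exact hl.one_lt.ne' (Int.natCast_dvd_natCast.1 (Dvd.intro_left n h2) |> Nat.dvd_one.1)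
  obtain ⟨P, hP, hle⟩ := Ideal.exists_le_maximal _ hne
  let _ : Field (𝓞 K ⧸ P) := Ideal.Quotient.field P
  refine ⟨𝓞 K ⧸ P, inferInstance, ?_, ⟨Ideal.Quotient.mk P⟩⟩
  rw [CharP.charP_iff_prime_eq_zero hl, ← map_natCast (Ideal.Quotient.mk P),
    Ideal.Quotient.eq_zero_iff_mem]
  exact hle (Ideal.mem_span_singleton_self _)

/-- Let `α = a + σ` be an element of norm `m ^ p` and trace `2 * a` of an imaginary quadratic
field, where `m` and `2 * a` are coprime. If `α` reduces to `r` or `r⁻¹` modulo a prime `l`, where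
`r` is not a `p`-th power, then `p` divides the class number. -/
theorem dvd_classNumber_of_imaginaryQuadratic {p : ℕ} (hp : p.Prime) {a m r : ℤ} {l e : ℕ}
    {σ : 𝓞 K} (hσ : σ ^ 2 = D) (hD : D < 0) (hDa : D = a ^ 2 - m ^ p)
    (hgen : ∀ z : K, ∃ x y : ℚ, z = x + y * σ) (ham : IsCoprime (2 * a) m)
    (hl : l.Prime) (hle : l = p * e + 1) (he : 12 ∣ e) (hm : (l : ℤ) ∣ m - 1)
    (har : (l : ℤ) ∣ 2 * a * r - (r ^ 2 + 1)) (hr : ¬ (l : ℤ) ∣ r ^ e - 1) :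
    p ∣ classNumber K := by
  have hσK : (σ : K) ^ 2 = D := by
    simpa using congrArg (algebraMap (𝓞 K) K) hσ
  by_contra hcard
  have hmul : (a + σ) * (a - σ) = (m : 𝓞 K) ^ p := by
    have : ((D : ℤ) : 𝓞 K) = a ^ 2 - m ^ p := by rw [hDa]; push_cast; rfl
    linear_combination -hσ - this
  have hcop : IsCoprime (a + σ) (a - σ : 𝓞 K) := by
    obtain ⟨v, w, hvw⟩ := ham.pow_right (n := p)
    have hvw' : (v : 𝓞 K) * (2 * a) + w * m ^ p = 1 := by exact_mod_cast congrArg (Int.cast) hvw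
    exact ⟨v + w * (a - σ), v, by rw [← hvw', ← hmul]; ring⟩
  have hne0 : (a + σ : 𝓞 K) ≠ 0 := by
    intro h
    apply ne_ratCast hσK hD (-a : ℚ)
    have := congrArg (algebraMap (𝓞 K) K) h
    simp only [map_add, map_intCast, map_zero] at this
    push_cast
    exact eq_neg_of_add_eq_zero_right this
  obtain ⟨β, u, hβ⟩ :=
    associated_pow_of_mul_eq_pow_of_not_dvd_card_classGroup hp hcard hcop hne0 hmul
  obtain ⟨k, _, _, ⟨π⟩⟩ := exists_ringHom_charP (K := K) l hl
  have : Fact l.Prime := ⟨hl⟩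
  have hcast (n : ℤ) : (n : k) = 0 ↔ (l : ℤ) ∣ n := CharP.intCast_eq_zero_iff k l n
  have hmk : (m : k) = 1 := by
    have := (hcast _).2 hm
    push_cast at this
    exact sub_eq_zero.1 this
  have hark : 2 * (a : k) * r = r ^ 2 + 1 := by
    have := (hcast _).2 har
    push_cast at this
    exact sub_eq_zero.1 this
  have hrk : (r : k) ^ e ≠ 1 := by
    intro h
    apply hr
    rw [← hcast]
    push_cast
    exact sub_eq_zero.2 h
  have hr0 : (r : k) ≠ 0 := by
    intro h
    simp [h] at hark
  have hσk : π σ ^ 2 = a ^ 2 - 1 := by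
    rw [← map_pow, hσ, hDa]
    simp [hmk]
  have hfac : (r * π (a + σ) - 1) * (π (a + σ) - r) = 0 := by
    simp only [map_add, map_intCast]
    linear_combination (r : k) * hσk + ((a : k) + π σ) * hark
  have hDk : ((2 * D : ℤ) : k) ≠ 0 := by
    intro h
    rw [hDa] at h
    push_cast at h
    rw [hmk, one_pow] at h
    have h2 : ((r : k) ^ 2 - 1) ^ 2 = 0 := by
      linear_combination 2 * (r : k) ^ 2 * h - (2 * (a : k) * r + r ^ 2 + 1) * hark
    have h3 : (r : k) ^ 2 = 1 := sub_eq_zero.1 (pow_eq_zero_iff (two_ne_zero) |>.1 h2)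
    obtain ⟨c, rfl⟩ := he
    apply hrk
    rw [show 12 * c = 2 * (6 * c) by ring, pow_mul, h3, one_pow]
  have hfixr : (r : k) ^ l = r := by
    rw [← frobenius_def, map_intCast]
  have hα0 : π (a + σ) ≠ 0 := by
    intro h
    rw [h] at hfac
    simp [hr0] at hfac
  have hfixα : π (a + σ) ^ l = π (a + σ) := by
    rcases mul_eq_zero.1 hfac with h | h
    · have h1 : π (a + σ) = (r : k)⁻¹ := eq_inv_of_mul_eq_one_right (sub_eq_zero.1 h)
      rw [h1, inv_pow, hfixr]
    · rw [sub_eq_zero.1 h, hfixr]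
  have hfixσ : π σ ^ l = π σ := by
    have h1 : π σ = π (a + σ) - (a : ℤ) := by simp
    rw [← frobenius_def, h1, map_sub, map_intCast, frobenius_def, hfixα]
  have hβfix := frobenius_map_eq_self π hσK hD hgen hfixσ hDk β
  have hβ0 : π β ≠ 0 := by
    intro h
    apply hα0
    rw [← hβ, map_mul, map_pow, h, zero_pow hp.ne_zero, zero_mul]
  have hβone : π β ^ (p * e) = 1 := by
    rw [hle, pow_succ] at hβfix
    exact mul_right_cancel₀ hβ0 (hβfix.trans (one_mul _).symm)
  have hαone : π (a + σ) ^ e = 1 := by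
    obtain ⟨c, rfl⟩ := he
    rw [← hβ, map_mul, mul_pow, map_pow, ← pow_mul, hβone, one_mul, pow_mul, ← map_pow,
      unit_pow_twelve_eq_one hσK hD hgen u, map_one, one_pow]
  apply hrk
  rcases mul_eq_zero.1 hfac with h | h
  · have h1 := congrArg (· ^ e) (sub_eq_zero.1 h)
    simpa only [mul_pow, hαone, mul_one, one_pow] using h1
  · rw [← sub_eq_zero.1 h, hαone]

/-- If a prime `q` exactly divides `D`, then `q` divides every `n > 0` such that `-n` is a square
in the imaginary quadratic field generated by a square root of `D`. -/
theorem dvd_of_sq_eq_neg (hs : s ^ 2 = D) (hD : D < 0)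
    (hgen : ∀ z : K, ∃ x y : ℚ, z = x + y * s) {q : ℕ} (hq : q.Prime)
    (hqD : padicValInt q D = 1) {n : ℕ} (hn : 0 < n) {z : K} (hz : z ^ 2 = -n) : q ∣ n := by
  have : Fact q.Prime := ⟨hq⟩
  obtain ⟨x, y, rfl⟩ := hgen z
  have hcoord : ((x ^ 2 + D * y ^ 2 + n : ℚ) : K) + ((2 * x * y : ℚ) : K) * s = 0 := by
    push_cast
    rw [← hs]
    linear_combination hz
  have hxy : 2 * x * y = 0 := by
    by_contra hne
    apply ne_ratCast hs hD (-(x ^ 2 + D * y ^ 2 + n) / (2 * x * y))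
    have : ((2 * x * y : ℚ) : K) ≠ 0 := by exact_mod_cast hne
    rw [Rat.cast_div, eq_div_iff this, Rat.cast_neg]
    linear_combination hcoord
  have h1 : x ^ 2 + D * y ^ 2 + n = 0 := by
    rw [hxy, Rat.cast_zero, zero_mul, add_zero] at hcoord
    exact_mod_cast hcoord
  have hn' : (0 : ℚ) < n := by exact_mod_cast hn
  have hy : y ≠ 0 := by
    rintro rfl
    nlinarith [sq_nonneg x]
  have hx : x = 0 := by simpa [hy] using hxy
  have hD' : (D : ℚ) ≠ 0 := by exact_mod_cast hD.ne
  have hval := congrArg (padicValRat q) (show (D : ℚ) * y ^ 2 = -n by rw [hx] at h1; linarith)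
  rw [padicValRat.mul hD' (pow_ne_zero 2 hy), padicValRat.pow, padicValRat.neg,
    padicValRat.of_int, padicValRat.of_nat, hqD] at hval
  rw [dvd_iff_padicValNat_ne_zero hn.ne']
  intro h
  rw [h] at hval
  push_cast at hval
  omega

end ImaginaryQuadratic

theorem exists_prime_and_not_pow {p : ℕ} (hp : p.Prime) :
    ∃ (l e : ℕ) (r : ℤ), l.Prime ∧ l = p * e + 1 ∧ 12 ∣ e ∧ ¬ (l : ℤ) ∣ r ^ e - 1 ∧
      ¬ (l : ℤ) ∣ r := by
  obtain ⟨l, hl, hl1, hmod⟩ :=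
    Nat.exists_prime_gt_modEq_one (k := 12 * p) 1 (by simp [hp.ne_zero])
  obtain ⟨c, hc⟩ := (Nat.modEq_iff_dvd' hl1.le).1 hmod.symm
  have hle : l = p * (12 * c) + 1 := by
    rw [show p * (12 * c) = 12 * p * c by ring]
    omega
  have : Fact l.Prime := ⟨hl⟩
  obtain ⟨g, hg⟩ := IsCyclic.exists_generator (α := (ZMod l)ˣ)
  have hord := orderOf_eq_card_of_forall_mem_zpowers hg
  rw [Nat.card_eq_fintype_card, ZMod.card_units] at hord
  obtain ⟨r, hr⟩ := ZMod.intCast_surjective (g : ZMod l)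
  refine ⟨l, 12 * c, r, hl, hle, ⟨c, rfl⟩, ?_, ?_⟩
  · rw [← ZMod.intCast_zmod_eq_zero_iff_dvd]
    push_cast
    rw [hr, sub_eq_zero]
    intro h
    have h1 : g ^ (12 * c) = 1 := Units.ext (by simpa using h)
    have hpos : 0 < 12 * c := by
      rcases Nat.eq_zero_or_pos (12 * c) with h0 | h0
      · rw [h0] at hle; omega
      · exact h0
    have h2 := Nat.le_of_dvd hpos (orderOf_dvd_of_pow_eq_one h1)
    have h3 : 2 * (12 * c) ≤ p * (12 * c) := Nat.mul_le_mul_right _ hp.two_le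
    omega
  · rw [← ZMod.intCast_zmod_eq_zero_iff_dvd, hr]
    exact g.ne_zero

theorem exists_trace_and_norm {p : ℕ} (hp : p.Prime) {l q : ℕ} {r : ℤ} (hl : l.Prime)
    (hl2 : 2 < l) (hr : ¬ (l : ℤ) ∣ r) (hq : q.Prime) (hlq : l < q) (hpq : p < q) :
    ∃ a m : ℤ, IsCoprime (2 * a) m ∧ (l : ℤ) ∣ m - 1 ∧ (l : ℤ) ∣ 2 * a * r - (r ^ 2 + 1) ∧
      a ^ 2 - m ^ p < 0 ∧ padicValInt q (a ^ 2 - m ^ p) = 1 := by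
  have hlZ : Prime (l : ℤ) := Nat.prime_iff_prime_int.1 hl
  have hqZ : Prime (q : ℤ) := Nat.prime_iff_prime_int.1 hq
  have hqnd {n : ℕ} (h0 : 0 < n) (h : n < q) : ¬ (q : ℤ) ∣ n := by
    rw [Int.natCast_dvd_natCast]
    exact Nat.not_dvd_of_pos_of_lt h0 h
  have hqn {n : ℕ} (h0 : 0 < n) (h : n < q) : IsCoprime (n : ℤ) q :=
    (hqZ.coprime_iff_not_dvd.2 (hqnd h0 h)).symm
  have hl2r : IsCoprime (l : ℤ) (2 * r) := by
    refine hlZ.coprime_iff_not_dvd.2 fun h => ?_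
    rcases hlZ.dvd_or_dvd h with h | h
    · exact Nat.not_dvd_of_pos_of_lt two_pos hl2 (by exact_mod_cast h)
    · exact hr h
  obtain ⟨u, v, huv⟩ := hl2r
  obtain ⟨u', v', huv'⟩ := (hqn hl.pos hlq).pow_right (n := 2)
  let a : ℤ := 1 + (v * (r ^ 2 + 1) - 1) * (v' * (q : ℤ) ^ 2)
  have haq : a = 1 + q ^ 2 * ((v * (r ^ 2 + 1) - 1) * v') := by simp only [a]; ring
  have hal : (l : ℤ) ∣ 2 * a * r - (r ^ 2 + 1) := by
    refine ⟨-u * (r ^ 2 + 1) - 2 * r * (v * (r ^ 2 + 1) - 1) * u', ?_⟩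
    simp only [a]
    linear_combination (r ^ 2 + 1) * huv + 2 * r * (v * (r ^ 2 + 1) - 1) * huv'
  clear_value a
  have hqa : IsCoprime a q :=
    ⟨1, -(q * ((v * (r ^ 2 + 1) - 1) * v')), by rw [haq]; ring⟩
  have hq2 : IsCoprime (2 : ℤ) q := by exact_mod_cast hqn two_pos (hl2.trans hlq)
  obtain ⟨w, t, hwt⟩ := (hq2.mul_left hqa).mul_left (hqn hl.pos hlq)
  generalize hA : 2 * a * (l : ℤ) = A at hwt
  have ha0 : a ≠ 0 := by
    rintro rfl
    exact hqZ.not_isUnit (isCoprime_zero_left.1 hqa)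
  have hA0 : A ≠ 0 := by
    rw [← hA]
    exact mul_ne_zero (mul_ne_zero two_ne_zero ha0) hlZ.ne_zero
  let T : ℤ := |w * A| + a ^ 2
  let c : ℤ := A * (w + q * (A * T))
  have hc : a ^ 2 ≤ c := by
    have h1 : 0 ≤ T := by positivity
    have h2 : 1 ≤ q * A ^ 2 := by
      have : 0 < (q : ℤ) * A ^ 2 := by have := hq.pos; positivity
      omega
    have h3 : -|w * A| ≤ w * A := neg_abs_le _
    have h4 : T ≤ q * A ^ 2 * T := le_mul_of_one_le_left h1 h2
    have h5 : c = w * A + q * A ^ 2 * T := by simp only [c]; ring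
    simp only [T] at h4 h5
    linarith
  have hcq : c = 1 + q * (A ^ 2 * T - t) := by
    simp only [c]
    linear_combination hwt
  have hcA : A ∣ c := Dvd.intro _ rfl
  clear_value c
  have hlA : (l : ℤ) ∣ A := hA ▸ Dvd.intro_left _ rfl
  have haA : 2 * a ∣ A := hA ▸ Dvd.intro _ rfl
  have hq1 : (1 : ℤ) < q := by exact_mod_cast hq.one_lt
  obtain ⟨d, hd⟩ := Polynomial.powAddExpansion 1 (q * c : ℤ) p
  have hfac : a ^ 2 - (1 + q * c) ^ p = q * (-p + q * (2 * ((v * (r ^ 2 + 1) - 1) * v') +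
      q ^ 2 * ((v * (r ^ 2 + 1) - 1) * v') ^ 2 - p * (A ^ 2 * T - t) - d * c ^ 2)) := by
    rw [hd, haq, one_pow, one_pow]
    linear_combination (-(p : ℤ) * q) * hcq
  have hneg : a ^ 2 - (1 + q * c) ^ p < 0 := by
    have h1 : 0 ≤ c := (sq_nonneg a).trans hc
    have h2 : c ≤ q * c := le_mul_of_one_le_left h1 hq1.le
    have h3 : 1 + q * c ≤ (1 + q * c) ^ p := le_self_pow₀ (by linarith) hp.ne_zero
    linarith
  refine ⟨a, 1 + q * c, ?_, ?_, hal, hneg, ?_⟩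
  · obtain ⟨b, hb⟩ := haA.trans hcA
    exact ⟨-(q * b), 1, by rw [hb]; ring⟩
  · rw [add_sub_cancel_left]
    exact (hlA.trans hcA).mul_left _
  · have : Fact q.Prime := ⟨hq⟩
    have hnd : ¬ (q : ℤ) ∣ -p + q * (2 * ((v * (r ^ 2 + 1) - 1) * v') +
        q ^ 2 * ((v * (r ^ 2 + 1) - 1) * v') ^ 2 - p * (A ^ 2 * T - t) - d * c ^ 2) := by
      rw [← dvd_sub_left (Dvd.intro _ rfl), add_sub_cancel_right, dvd_neg]
      exact hqnd hp.pos hpq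
    have hne : -p + q * (2 * ((v * (r ^ 2 + 1) - 1) * v') +
        q ^ 2 * ((v * (r ^ 2 + 1) - 1) * v') ^ 2 - p * (A ^ 2 * T - t) - d * c ^ 2) ≠ 0 :=
      fun h => hnd (h ▸ dvd_zero _)
    rw [hfac, padicValInt.mul hqZ.ne_zero hne,
      padicValInt.self hq.one_lt, padicValInt.eq_zero_of_not_dvd hnd]

theorem exists_add_mul_of_sq_eq {F E : Type*} [Field F] [Field E] [Algebra F E] {s : E} {d : F}
    (hs : s ^ 2 = algebraMap F E d) {z : E} (hz : z ∈ F⟮s⟯) :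
    ∃ x y : F, z = algebraMap F E x + algebraMap F E y * s := by
  have halg : IsAlgebraic F s :=
    (IsIntegral.of_pow two_pos (hs ▸ isIntegral_algebraMap)).isAlgebraic
  rw [← mem_toSubalgebra, adjoin_simple_toSubalgebra_of_isAlgebraic halg] at hz
  induction hz using Algebra.adjoin_induction with
  | mem x hx => exact ⟨0, 1, by simpa using hx⟩
  | algebraMap r => exact ⟨r, 0, by simp⟩
  | add x y _ _ hx hy =>
    obtain ⟨a, b, rfl⟩ := hx
    obtain ⟨a', b', rfl⟩ := hy
    exact ⟨a + a', b + b', by simp only [map_add]; ring⟩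
  | mul x y _ _ hx hy =>
    obtain ⟨a, b, rfl⟩ := hx
    obtain ⟨a', b', rfl⟩ := hy
    exact ⟨a * a' + d * (b * b'), a * b' + b * a', by
      simp only [map_add, map_mul]
      rw [← hs]
      ring⟩

/-- For every prime number `p`, there exist infinitely many pairwise distinct
number fields `L` (realized as finite-dimensional subfields of a fixed algebraic
closure of `ℚ`) such that `p` divides the class number of `L`. -/
theorem stmt_5 (p : ℕ) (hp : p.Prime) :
    {L : IntermediateField ℚ (AlgebraicClosure ℚ) |
      ∃ hL : FiniteDimensional ℚ L,
        p ∣ @NumberField.classNumber L _ (@NumberField.mk L _ inferInstance hL)}.Infinite := by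
  obtain ⟨l, e, r, hl, hle, he, hre, hr⟩ := exists_prime_and_not_pow hp
  have hl2 : 2 < l := by
    obtain ⟨c, rfl⟩ := he
    have hc : c ≠ 0 := by
      rintro rfl
      exact hre (by simp)
    have := Nat.mul_pos hp.pos (Nat.pos_of_ne_zero hc)
    rw [show p * (12 * c) = 12 * (p * c) by ring] at hle
    omega
  -- The least `n > 0` such that `-n` is a square is unbounded on the set.
  let f : IntermediateField ℚ (AlgebraicClosure ℚ) → ℕ :=
    fun L => sInf {n : ℕ | 0 < n ∧ ∃ z : L, z ^ 2 = -n}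
  refine Set.Infinite.of_image f (Set.infinite_of_not_bddAbove ?_)
  rintro ⟨B, hB⟩
  obtain ⟨q, hqB, hq⟩ := Nat.exists_infinite_primes (B + l + p + 1)
  obtain ⟨a, m, ham, hlm, hla, hneg, hval⟩ :=
    exists_trace_and_norm (r := r) hp hl hl2 hr hq (by omega) (by omega)
  generalize hD : a ^ 2 - m ^ p = D at hneg hval
  obtain ⟨s, hs⟩ := IsAlgClosed.exists_pow_nat_eq (D : AlgebraicClosure ℚ) two_pos
  have hsQ : s ^ 2 = algebraMap ℚ (AlgebraicClosure ℚ) D := by simpa using hs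
  let L := ℚ⟮s⟯
  have hfin : FiniteDimensional ℚ L :=
    adjoin.finiteDimensional (IsIntegral.of_pow two_pos (hsQ ▸ isIntegral_algebraMap))
  have hnf : NumberField L := @NumberField.mk L _ inferInstance hfin
  let σ : L := AdjoinSimple.gen ℚ s
  have hσ : σ ^ 2 = D := Subtype.ext (by simpa [σ] using hs)
  have hgen (z : L) : ∃ x y : ℚ, z = x + y * σ := by
    obtain ⟨x, y, h⟩ := exists_add_mul_of_sq_eq hsQ z.2
    exact ⟨x, y, Subtype.ext (by simpa [σ] using h)⟩
  have hσint : IsIntegral ℤ σ := IsIntegral.of_pow two_pos (hσ ▸ isIntegral_algebraMap)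
  let τ : 𝓞 L := ⟨σ, hσint⟩
  have hmem : f L ∈ f '' {L : IntermediateField ℚ (AlgebraicClosure ℚ) |
      ∃ hL : FiniteDimensional ℚ L,
        p ∣ @NumberField.classNumber L _ (@NumberField.mk L _ inferInstance hL)} := by
    refine Set.mem_image_of_mem f ⟨hfin, ?_⟩
    exact dvd_classNumber_of_imaginaryQuadratic (σ := τ) (D := D) hp
      (RingOfIntegers.coe_injective (by rw [map_pow, map_intCast]; exact hσ)) hneg hD.symm hgen
      ham hl hle he hlm hla hre
  have hqf : q ≤ f L := by
    have hne : {n : ℕ | 0 < n ∧ ∃ z : L, z ^ 2 = -n}.Nonempty := by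
      refine ⟨D.natAbs, by omega, σ, ?_⟩
      rw [hσ, Nat.cast_natAbs, abs_of_neg hneg]
      simp
    refine le_csInf hne ?_
    rintro n ⟨hn, z, hz⟩
    exact Nat.le_of_dvd hn (dvd_of_sq_eq_neg hσ hneg hgen hq hval hn hz)
  have := hB hmem
  omega
end
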